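/- arXiv:1806.03928 — 7 statements merged into one kernel-verified Lean document; each statement's English description precedes it below -/
import Mathlib

section
/- Let u ∈ V be the primal solution, z ∈ V the dual solution, and let W ⊆ V be a closed subspace with primal Galerkin solution u_W ∈ W and dual Galerkin solution z_W ∈ W. Then G(u) − G(u_W) = B(u − u_W, z − z_W). -/
/-- Goal-oriented error representation: `G(u) − G(u_W) = B(u − u_W, z − z_W)`. -/
theorem goal_error_representation
    {V : Type*} [NormedAddCommGroup V] [InnerProductSpace ℝ V] [CompleteSpace V]
    (B : V →ₗ[ℝ] V →ₗ[ℝ] ℝ)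
    (hBsymm : ∀ v w : V, B v w = B w v)
    (hBbdd : ∃ M : ℝ, ∀ v w : V, |B v w| ≤ M * ‖v‖ * ‖w‖)
    (hBcoer : ∃ c : ℝ, 0 < c ∧ ∀ v : V, c * ‖v‖ ^ 2 ≤ B v v)
    (F G : V →L[ℝ] ℝ)
    (u z : V)
    (hu : ∀ v : V, B u v = F v)
    (hz : ∀ v : V, B v z = G v)
    (W : Submodule ℝ V) (hW : IsClosed (W : Set V))
    (uW zW : V) (huWmem : uW ∈ W) (hzWmem : zW ∈ W)
    (huW : ∀ w ∈ W, B uW w = F w)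
    (hzW : ∀ w ∈ W, B w zW = G w) :
    G u - G uW = B (u - uW) (z - zW) := by
  simp only [map_sub, LinearMap.sub_apply, hz, hu, huW zW hzWmem]
  ring
end

section
/- Let u ∈ V be the primal solution, z ∈ V the dual solution, and let W ⊆ V be a closed subspace with primal Galerkin solution u_W ∈ W and dual Galerkin solution z_W ∈ W. Then |G(u) − G(u_W)| ≤ |||u − u_W||| · |||z − z_W|||, where |||v||| := B(v,v)^{1/2} denotes the energy norm. -/
/-- `|G(u) − G(u_W)| ≤ |||u − u_W||| · |||z − z_W|||` with the energy norm
`|||v||| = B(v,v)^{1/2}`. -/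
theorem goal_error_product_bound
    {V : Type*} [NormedAddCommGroup V] [InnerProductSpace ℝ V] [CompleteSpace V]
    (B : V →ₗ[ℝ] V →ₗ[ℝ] ℝ)
    (hBsymm : ∀ v w : V, B v w = B w v)
    (hBbdd : ∃ M : ℝ, ∀ v w : V, |B v w| ≤ M * ‖v‖ * ‖w‖)
    (hBcoer : ∃ c : ℝ, 0 < c ∧ ∀ v : V, c * ‖v‖ ^ 2 ≤ B v v)
    (F G : V →L[ℝ] ℝ)
    (u z : V)
    (hu : ∀ v : V, B u v = F v)
    (hz : ∀ v : V, B v z = G v)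
    (W : Submodule ℝ V) (hW : IsClosed (W : Set V))
    (uW zW : V) (huWmem : uW ∈ W) (hzWmem : zW ∈ W)
    (huW : ∀ w ∈ W, B uW w = F w)
    (hzW : ∀ w ∈ W, B w zW = G w) :
    |G u - G uW| ≤
      Real.sqrt (B (u - uW) (u - uW)) * Real.sqrt (B (z - zW) (z - zW)) := by
  obtain ⟨c, hc, hcoer⟩ := hBcoer
  have hnonneg (v : V) : 0 ≤ B v v :=
    le_trans (mul_nonneg hc.le (sq_nonneg ‖v‖)) (hcoer v)
  have horth : B (u - uW) zW = 0 := by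
    rw [map_sub, LinearMap.sub_apply, hu, huW zW hzWmem, sub_self]
  have herr : G u - G uW = B (u - uW) (z - zW) := by
    rw [map_sub (B (u - uW)), horth, sub_zero, hz, map_sub]
  rw [herr, ← Real.sqrt_mul (hnonneg _)]
  exact Real.abs_le_sqrt (LinearMap.BilinForm.apply_sq_le_of_symm B hnonneg ⟨hBsymm⟩ _ _)
end

section
/- Let u ∈ V be the primal solution, let W ⊆ Ŵ ⊆ V be closed subspaces with primal Galerkin solutions u_W ∈ W and u_Ŵ ∈ Ŵ, and let 0 ≤ β < 1. Then the saturation property |||u − u_Ŵ||| ≤ β·|||u − u_W||| holds if and only if the reliability property |||u − u_W||| ≤ (1 − β²)^{−1/2}·|||u_Ŵ − u_W||| holds. -/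
/-- Pythagoras' identity for a symmetric bilinear form. -/
theorem bilin_add_self_of_orthogonal {R M : Type*} [CommRing R] [AddCommGroup M] [Module R M]
    (B : M →ₗ[R] M →ₗ[R] R) (hB : ∀ v w : M, B v w = B w v) {v w : M} (h : B v w = 0) :
    B (v + w) (v + w) = B v v + B w w := by
  simp [h, hB w v]

/-- Equivalence of the saturation assumption and the reliability of the
two-level error estimate, with constant `(1 − β²)^{−1/2}`;
`Wh` is the enriched space `Ŵ` and `uh` the Galerkin solution `u_Ŵ`. -/
theorem saturation_iff_reliability
    {V : Type*} [NormedAddCommGroup V] [InnerProductSpace ℝ V] [CompleteSpace V]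
    (B : V →ₗ[ℝ] V →ₗ[ℝ] ℝ)
    (hBsymm : ∀ v w : V, B v w = B w v)
    (hBbdd : ∃ M : ℝ, ∀ v w : V, |B v w| ≤ M * ‖v‖ * ‖w‖)
    (hBcoer : ∃ c : ℝ, 0 < c ∧ ∀ v : V, c * ‖v‖ ^ 2 ≤ B v v)
    (F : V →L[ℝ] ℝ)
    (u : V) (hu : ∀ v : V, B u v = F v)
    (W Wh : Submodule ℝ V) (hWWh : W ≤ Wh)
    (hW : IsClosed (W : Set V)) (hWh : IsClosed (Wh : Set V))
    (uW : V) (huWmem : uW ∈ W) (huW : ∀ w ∈ W, B uW w = F w)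
    (uh : V) (huhmem : uh ∈ Wh) (huh : ∀ w ∈ Wh, B uh w = F w)
    (β : ℝ) (hβ0 : 0 ≤ β) (hβ1 : β < 1) :
    Real.sqrt (B (u - uh) (u - uh)) ≤ β * Real.sqrt (B (u - uW) (u - uW)) ↔
      Real.sqrt (B (u - uW) (u - uW)) ≤
        (Real.sqrt (1 - β ^ 2))⁻¹ * Real.sqrt (B (uh - uW) (uh - uW)) := by
  have hnonneg : ∀ v : V, 0 ≤ B v v := fun v => by
    obtain ⟨c, hc, h⟩ := hBcoer
    exact le_trans (by positivity) (h v)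
  have horth : B (u - uh) (uh - uW) = 0 := by
    have hmem : uh - uW ∈ Wh := Wh.sub_mem huhmem (hWWh huWmem)
    rw [map_sub B, LinearMap.sub_apply, hu, huh _ hmem, sub_self]
  have hpyth := bilin_add_self_of_orthogonal B hBsymm horth
  rw [sub_add_sub_cancel] at hpyth
  have hs : 0 < 1 - β ^ 2 := by nlinarith
  have hβ : β * Real.sqrt (B (u - uW) (u - uW)) =
      Real.sqrt (β ^ 2 * B (u - uW) (u - uW)) := by
    rw [Real.sqrt_mul (sq_nonneg β), Real.sqrt_sq hβ0]
  rw [hβ, Real.sqrt_le_sqrt_iff (mul_nonneg (sq_nonneg β) (hnonneg _)),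
    le_inv_mul_iff₀ (Real.sqrt_pos.2 hs), ← Real.sqrt_mul hs.le,
    Real.sqrt_le_sqrt_iff (hnonneg _)]
  constructor <;> intro h <;> linarith
end

section
/- Let Ŵ ⊆ V be a closed subspace, let û ∈ Ŵ be the B-Galerkin solution of F on Ŵ, let w₀ ∈ Ŵ be arbitrary, and let ê ∈ Ŵ be the unique element satisfying B₀(ê, w) = F(w) − B(w₀, w) for all w ∈ Ŵ. Then λ·B₀(ê, ê) ≤ B(û − w₀, û − w₀) ≤ Λ·B₀(ê, ê). -/
/-- Weighted Young inequality for a symmetric positive semidefinite bilinear form. -/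
theorem two_mul_bilin_le_of_symm_of_nonneg {V : Type*} [AddCommGroup V] [Module ℝ V]
    (A : V →ₗ[ℝ] V →ₗ[ℝ] ℝ) (hsymm : ∀ v w : V, A v w = A w v) (hnonneg : ∀ v : V, 0 ≤ A v v)
    (t : ℝ) (x y : V) : 2 * t * A x y ≤ t ^ 2 * A x x + A y y := by
  have h := hnonneg (t • x - y)
  simp only [map_sub, map_smul, LinearMap.sub_apply, LinearMap.smul_apply, smul_eq_mul,
    hsymm y x] at h
  linarith

/-- Equivalence of the energy error `B(û − w₀, û − w₀)` and the hierarchical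
estimator `B₀(ê, ê)`:  `λ·B₀(ê,ê) ≤ B(û − w₀, û − w₀) ≤ Λ·B₀(ê,ê)`.
Here `Wh` is the enriched space `Ŵ`, `uh` the Galerkin solution `û`,
and `eh` the estimator `ê`. -/
theorem hierarchical_estimator_equivalence
    {V : Type*} [NormedAddCommGroup V] [InnerProductSpace ℝ V] [CompleteSpace V]
    (B B₀ : V →ₗ[ℝ] V →ₗ[ℝ] ℝ)
    (hBsymm : ∀ v w : V, B v w = B w v)
    (hBbdd : ∃ M : ℝ, ∀ v w : V, |B v w| ≤ M * ‖v‖ * ‖w‖)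
    (hBcoer : ∃ c : ℝ, 0 < c ∧ ∀ v : V, c * ‖v‖ ^ 2 ≤ B v v)
    (hB₀symm : ∀ v w : V, B₀ v w = B₀ w v)
    (hB₀bdd : ∃ M : ℝ, ∀ v w : V, |B₀ v w| ≤ M * ‖v‖ * ‖w‖)
    (hB₀coer : ∃ c : ℝ, 0 < c ∧ ∀ v : V, c * ‖v‖ ^ 2 ≤ B₀ v v)
    (lam Lam : ℝ) (hlam : 0 < lam) (hLam : 0 < Lam)
    (hequiv : ∀ v : V, lam * B v v ≤ B₀ v v ∧ B₀ v v ≤ Lam * B v v)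
    (F : V →L[ℝ] ℝ)
    (Wh : Submodule ℝ V) (hWh : IsClosed (Wh : Set V))
    (uh : V) (huhmem : uh ∈ Wh) (huh : ∀ w ∈ Wh, B uh w = F w)
    (w₀ : V) (hw₀ : w₀ ∈ Wh)
    (eh : V) (hehmem : eh ∈ Wh)
    (heh : ∀ w ∈ Wh, B₀ eh w = F w - B w₀ w) :
    lam * B₀ eh eh ≤ B (uh - w₀) (uh - w₀) ∧
      B (uh - w₀) (uh - w₀) ≤ Lam * B₀ eh eh := by
  have hBnonneg (v : V) : 0 ≤ B v v := by
    obtain ⟨c, hc, h⟩ := hBcoer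
    exact (by positivity : 0 ≤ c * ‖v‖ ^ 2).trans (h v)
  have hB₀nonneg (v : V) : 0 ≤ B₀ v v := (mul_nonneg hlam.le (hBnonneg v)).trans (hequiv v).1
  have hresidual (w : V) (hw : w ∈ Wh) : B₀ eh w = B (uh - w₀) w := by
    rw [heh w hw, map_sub, LinearMap.sub_apply, huh w hw]
  have hee := hresidual eh hehmem
  have hed := hresidual (uh - w₀) (Wh.sub_mem huhmem hw₀)
  constructor
  · have h := two_mul_bilin_le_of_symm_of_nonneg B hBsymm hBnonneg lam eh (uh - w₀)
    rw [hBsymm eh, ← hee] at h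
    have hle := mul_le_mul_of_nonneg_left (hequiv eh).1 hlam.le
    linarith
  · have h := two_mul_bilin_le_of_symm_of_nonneg B₀ hB₀symm hB₀nonneg Lam eh (uh - w₀)
    rw [hed] at h
    have hle := (hequiv (uh - w₀)).2
    refine le_of_mul_le_mul_left ?_ hLam
    linarith
end

section
/- Let W ⊆ Ŵ ⊆ V be closed subspaces, let u_W ∈ W and û ∈ Ŵ be the B-Galerkin solutions of F on W and Ŵ respectively, and let U₁, …, U_m be closed subspaces of Ŵ with B₀-orthogonal projections G₁, …, G_m. Assume there exist constants C ≥ 1 and K ≥ 1 such that for every v̂ ∈ Ŵ with B₀(v̂, w) = 0 for all w ∈ W one has C^{-1}·B₀(v̂, v̂) ≤ Σ_{j=1}^{m} B₀(G_j v̂, G_j v̂) ≤ K·B₀(v̂, v̂). For each j let e_j ∈ U_j be the unique element with B₀(e_j, w) = F(w) − B(u_W, w) for all w ∈ U_j, and set μ² := Σ_{j=1}^{m} B₀(e_j, e_j). Then (λ/K)·μ² ≤ B(û − u_W, û − u_W) ≤ Λ·C·μ². -/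
/-- Lax–Milgram on a closed subspace: a bounded coercive bilinear form represents every bounded
linear functional on it. -/
theorem exists_mem_forall_eq_of_coercive
    {V : Type*} [NormedAddCommGroup V] [InnerProductSpace ℝ V] [CompleteSpace V]
    (A : V →ₗ[ℝ] V →ₗ[ℝ] ℝ)
    (hbdd : ∃ M : ℝ, ∀ v w : V, |A v w| ≤ M * ‖v‖ * ‖w‖)
    (hcoer : ∃ c : ℝ, 0 < c ∧ ∀ v : V, c * ‖v‖ ^ 2 ≤ A v v)
    (S : Submodule ℝ V) (hS : IsClosed (S : Set V)) (f : V →L[ℝ] ℝ) :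
    ∃ v ∈ S, ∀ w ∈ S, A v w = f w := by
  obtain ⟨M, hM⟩ := hbdd
  obtain ⟨c, hc, hcA⟩ := hcoer
  have : CompleteSpace S := hS.completeSpace_coe
  let T : S →L[ℝ] S →L[ℝ] ℝ :=
    (A.domRestrict₁₂ S S).mkContinuous₂ M fun v w => hM v w
  have hT : ∀ v w : S, T v w = A v w := fun _ _ => rfl
  have hcoerT : IsCoercive T := by
    refine ⟨c, hc, fun v => ?_⟩
    have h := hcA v
    rw [hT]
    simpa [pow_two, mul_assoc] using h
  let r : S := (InnerProductSpace.toDual ℝ S).symm (f.comp S.subtypeL)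
  refine ⟨hcoerT.continuousLinearEquivOfBilin.symm r, Subtype.property _, fun w hw => ?_⟩
  have h := hcoerT.continuousLinearEquivOfBilin_apply
    (hcoerT.continuousLinearEquivOfBilin.symm r) ⟨w, hw⟩
  rw [ContinuousLinearEquiv.apply_symm_apply, hT] at h
  rw [← h]
  exact InnerProductSpace.toDual_symm_apply


/-- Abstract two-level a posteriori estimate (core of Theorem 3.1, estimate
(3.13)): `(λ/K)·μ² ≤ B(û − u_W, û − u_W) ≤ Λ·C·μ²`.
Here `Wh` denotes `Ŵ`, `uh` denotes `û`, and `G j` is the `B₀`-orthogonal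
projection onto `U j`. -/
theorem abstract_twolevel_estimate
    {V : Type*} [NormedAddCommGroup V] [InnerProductSpace ℝ V] [CompleteSpace V]
    (B B₀ : V →ₗ[ℝ] V →ₗ[ℝ] ℝ)
    (hBsymm : ∀ v w : V, B v w = B w v)
    (hBbdd : ∃ M : ℝ, ∀ v w : V, |B v w| ≤ M * ‖v‖ * ‖w‖)
    (hBcoer : ∃ c : ℝ, 0 < c ∧ ∀ v : V, c * ‖v‖ ^ 2 ≤ B v v)
    (hB₀symm : ∀ v w : V, B₀ v w = B₀ w v)
    (hB₀bdd : ∃ M : ℝ, ∀ v w : V, |B₀ v w| ≤ M * ‖v‖ * ‖w‖)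
    (hB₀coer : ∃ c : ℝ, 0 < c ∧ ∀ v : V, c * ‖v‖ ^ 2 ≤ B₀ v v)
    (lam Lam : ℝ) (hlam : 0 < lam) (hLam : 0 < Lam)
    (hequiv : ∀ v : V, lam * B v v ≤ B₀ v v ∧ B₀ v v ≤ Lam * B v v)
    (F : V →L[ℝ] ℝ)
    (W Wh : Submodule ℝ V) (hWWh : W ≤ Wh)
    (hW : IsClosed ((W : Set V))) (hWh : IsClosed ((Wh : Set V)))
    (uW : V) (huWmem : uW ∈ W) (huW : ∀ w ∈ W, B uW w = F w)
    (uh : V) (huhmem : uh ∈ Wh) (huh : ∀ w ∈ Wh, B uh w = F w)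
    (m : ℕ) (U : Fin m → Submodule ℝ V)
    (hUc : ∀ j, IsClosed ((U j : Set V))) (hUWh : ∀ j, U j ≤ Wh)
    (G : Fin m → V → V)
    (hGmem : ∀ j v, G j v ∈ U j)
    (hGorth : ∀ j v, ∀ w ∈ U j, B₀ (v - G j v) w = 0)
    (C K : ℝ) (hC : 1 ≤ C) (hK : 1 ≤ K)
    (hframe : ∀ vh ∈ Wh, (∀ w ∈ W, B₀ vh w = 0) →
      C⁻¹ * B₀ vh vh ≤ ∑ j, B₀ (G j vh) (G j vh) ∧
        ∑ j, B₀ (G j vh) (G j vh) ≤ K * B₀ vh vh)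
    (e : Fin m → V) (hemem : ∀ j, e j ∈ U j)
    (he : ∀ j, ∀ w ∈ U j, B₀ (e j) w = F w - B uW w)
    (μsq : ℝ) (hμsq : μsq = ∑ j, B₀ (e j) (e j)) :
    lam / K * μsq ≤ B (uh - uW) (uh - uW) ∧
      B (uh - uW) (uh - uW) ≤ Lam * C * μsq := by
  have hnonneg : ∀ v, 0 ≤ B v v := fun v => by
    obtain ⟨c, hc, h⟩ := hBcoer
    exact (by positivity : 0 ≤ c * ‖v‖ ^ 2).trans (h v)
  have hnonneg₀ : ∀ v, 0 ≤ B₀ v v := fun v => by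
    obtain ⟨c, hc, h⟩ := hB₀coer
    exact (by positivity : 0 ≤ c * ‖v‖ ^ 2).trans (h v)
  have hdefinite₀ : ∀ v, B₀ v v = 0 → v = 0 := fun v hv => by
    obtain ⟨c, hc, h⟩ := hB₀coer
    have hle := h v
    rw [hv] at hle
    have hsq : ‖v‖ ^ 2 = 0 :=
      le_antisymm (nonpos_of_mul_nonpos_right hle hc) (sq_nonneg _)
    simpa using hsq
  set d := uh - uW with hd
  have hdmem : d ∈ Wh := Wh.sub_mem huhmem (hWWh huWmem)
  have hdB : ∀ w ∈ Wh, B d w = F w - B uW w := fun w hw => by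
    simp [hd, huh w hw]
  obtain ⟨M, hM⟩ := hBbdd
  obtain ⟨r, hrmem, hr⟩ := exists_mem_forall_eq_of_coercive B₀ hB₀bdd hB₀coer Wh hWh
    ((B d).mkContinuous (M * ‖d‖) fun w => hM d w)
  replace hr : ∀ w ∈ Wh, B₀ r w = B d w := hr
  have hrW : ∀ w ∈ W, B₀ r w = 0 := fun w hw => by
    rw [hr w (hWWh hw), hdB w (hWWh hw), huW w hw, sub_self]
  have hGr : ∀ j, G j r = e j := fun j => by
    have hmem : G j r - e j ∈ U j := (U j).sub_mem (hGmem j r) (hemem j)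
    have horth := hGorth j r _ hmem
    have heq := he j _ hmem
    rw [← hdB _ (hUWh j hmem), ← hr _ (hUWh j hmem)] at heq
    refine sub_eq_zero.mp (hdefinite₀ _ ?_)
    rw [map_sub B₀, LinearMap.sub_apply] at horth
    rw [map_sub B₀, LinearMap.sub_apply, heq]
    linarith
  obtain ⟨hlower, hupper⟩ := hframe r hrmem hrW
  simp only [hGr, ← hμsq] at hlower hupper
  have hrr := hr r hrmem
  have hrd := hr d hdmem
  have hle_r : lam * B₀ r r ≤ B d d := by
    have h := hnonneg (d - lam • r)
    simp only [map_sub, map_smul, LinearMap.sub_apply, LinearMap.smul_apply, smul_eq_mul] at h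
    rw [hBsymm r d, ← hrr] at h
    nlinarith [mul_le_mul_of_nonneg_left (hequiv r).1 hlam.le]
  have hle_d : B d d ≤ Lam * B₀ r r := by
    have h := hnonneg₀ (d - Lam • r)
    simp only [map_sub, map_smul, LinearMap.sub_apply, LinearMap.smul_apply, smul_eq_mul] at h
    rw [hB₀symm d r, hrd] at h
    refine le_of_mul_le_mul_left ?_ hLam
    nlinarith [(hequiv d).2]
  have hCpos : 0 < C := one_pos.trans_le hC
  have hKpos : 0 < K := one_pos.trans_le hK
  constructor
  · calc lam / K * μsq ≤ lam / K * (K * B₀ r r) := by gcongr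
      _ = lam * B₀ r r := by field_simp
      _ ≤ B d d := hle_r
  · calc B d d ≤ Lam * B₀ r r := hle_d
      _ ≤ Lam * (C * μsq) := by
        gcongr
        exact (inv_mul_le_iff₀ hCpos).mp hlower
      _ = Lam * C * μsq := by ring
end

section
/- In the setting of the abstract two-level estimate, assume additionally that u ∈ V is the primal solution (B(u, v) = F(v) for all v ∈ V) and that the saturation assumption holds: |||u − û||| ≤ β·|||u − u_W||| for some 0 ≤ β < 1, where |||v||| := B(v,v)^{1/2}. Then (λ/K)·μ² ≤ |||u − u_W|||² ≤ (Λ·C/(1 − β²))·μ². -/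
/-- Lax–Milgram on a closed subspace, for unbundled bounded coercive bilinear forms. -/
theorem exists_mem_forall_bilin_eq {V : Type*} [NormedAddCommGroup V] [InnerProductSpace ℝ V]
    [CompleteSpace V] (A : V →ₗ[ℝ] V →ₗ[ℝ] ℝ)
    (hbdd : ∃ M : ℝ, ∀ v w : V, |A v w| ≤ M * ‖v‖ * ‖w‖)
    (hcoer : ∃ c : ℝ, 0 < c ∧ ∀ v : V, c * ‖v‖ ^ 2 ≤ A v v)
    (S : Submodule ℝ V) (hS : IsClosed (S : Set V)) (f : V →L[ℝ] ℝ) :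
    ∃ x ∈ S, ∀ w ∈ S, A x w = f w := by
  obtain ⟨M, hM⟩ := hbdd
  obtain ⟨c, hc, hA⟩ := hcoer
  have : CompleteSpace S := hS.completeSpace_coe
  let T : S →L[ℝ] S →L[ℝ] ℝ :=
    (A.domRestrict₁₂ S S).mkContinuous₂ M fun v w => hM v w
  have hT : IsCoercive T := ⟨c, hc, fun v => by
    have h := hA v
    rw [pow_two, ← mul_assoc] at h
    exact h⟩
  let y : S := (InnerProductSpace.toDual ℝ S).symm (f.comp S.subtypeL)
  let x : S := hT.continuousLinearEquivOfBilin.symm y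
  refine ⟨x, x.2, fun w hw => ?_⟩
  have h := hT.continuousLinearEquivOfBilin_apply x ⟨w, hw⟩
  rw [ContinuousLinearEquiv.apply_symm_apply, InnerProductSpace.toDual_symm_apply] at h
  exact h.symm

/-- If `B₀ x x = B d x` and `B₀ x d = B d d`, spectral equivalence of the forms transfers to
the energies of `x` and `d`. -/
theorem energy_bounds_of_riesz_representative {V : Type*} [AddCommGroup V] [Module ℝ V]
    (B B₀ : V →ₗ[ℝ] V →ₗ[ℝ] ℝ)
    (hBsymm : ∀ v w : V, B v w = B w v) (hB₀symm : ∀ v w : V, B₀ v w = B₀ w v)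
    (hBnonneg : ∀ v : V, 0 ≤ B v v) (hB₀nonneg : ∀ v : V, 0 ≤ B₀ v v)
    {lam Lam : ℝ} (hlam : 0 < lam) (hLam : 0 < Lam)
    (hequiv : ∀ v : V, lam * B v v ≤ B₀ v v ∧ B₀ v v ≤ Lam * B v v)
    {x d : V} (hxx : B₀ x x = B d x) (hxd : B₀ x d = B d d) :
    lam * B₀ x x ≤ B d d ∧ B d d ≤ Lam * B₀ x x := by
  constructor
  · have h := hBnonneg (d - lam • x)
    simp only [map_sub, map_smul, LinearMap.sub_apply, LinearMap.smul_apply, smul_eq_mul,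
      hBsymm x d, ← hxx] at h
    nlinarith [mul_le_mul_of_nonneg_left (hequiv x).1 hlam.le]
  · have h := hB₀nonneg (Lam • x - d)
    simp only [map_sub, map_smul, LinearMap.sub_apply, LinearMap.smul_apply, smul_eq_mul,
      hB₀symm d x, hxd] at h
    have h' : 0 ≤ Lam * (Lam * B₀ x x - B d d) := by linarith [(hequiv d).2]
    linarith [nonneg_of_mul_nonneg_right h' hLam]

/-- Reliability and efficiency of the two-level estimate with respect to the
true energy error (Theorem 3.1, estimate (3.14)): under the saturation
assumption `|||u − û||| ≤ β·|||u − u_W|||`,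
`(λ/K)·μ² ≤ |||u − u_W|||² ≤ (Λ·C/(1 − β²))·μ²`, where `|||v||| = B(v,v)^{1/2}`.
Here `Wh` denotes `Ŵ` and `uh` denotes `û`. -/
theorem twolevel_estimate_reliable_efficient
    {V : Type*} [NormedAddCommGroup V] [InnerProductSpace ℝ V] [CompleteSpace V]
    (B B₀ : V →ₗ[ℝ] V →ₗ[ℝ] ℝ)
    (hBsymm : ∀ v w : V, B v w = B w v)
    (hBbdd : ∃ M : ℝ, ∀ v w : V, |B v w| ≤ M * ‖v‖ * ‖w‖)
    (hBcoer : ∃ c : ℝ, 0 < c ∧ ∀ v : V, c * ‖v‖ ^ 2 ≤ B v v)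
    (hB₀symm : ∀ v w : V, B₀ v w = B₀ w v)
    (hB₀bdd : ∃ M : ℝ, ∀ v w : V, |B₀ v w| ≤ M * ‖v‖ * ‖w‖)
    (hB₀coer : ∃ c : ℝ, 0 < c ∧ ∀ v : V, c * ‖v‖ ^ 2 ≤ B₀ v v)
    (lam Lam : ℝ) (hlam : 0 < lam) (hLam : 0 < Lam)
    (hequiv : ∀ v : V, lam * B v v ≤ B₀ v v ∧ B₀ v v ≤ Lam * B v v)
    (F : V →L[ℝ] ℝ)
    (u : V) (hu : ∀ v : V, B u v = F v)
    (W Wh : Submodule ℝ V) (hWWh : W ≤ Wh)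
    (hW : IsClosed ((W : Set V))) (hWh : IsClosed ((Wh : Set V)))
    (uW : V) (huWmem : uW ∈ W) (huW : ∀ w ∈ W, B uW w = F w)
    (uh : V) (huhmem : uh ∈ Wh) (huh : ∀ w ∈ Wh, B uh w = F w)
    (m : ℕ) (U : Fin m → Submodule ℝ V)
    (hUc : ∀ j, IsClosed ((U j : Set V))) (hUWh : ∀ j, U j ≤ Wh)
    (G : Fin m → V → V)
    (hGmem : ∀ j v, G j v ∈ U j)
    (hGorth : ∀ j v, ∀ w ∈ U j, B₀ (v - G j v) w = 0)
    (C K : ℝ) (hC : 1 ≤ C) (hK : 1 ≤ K)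
    (hframe : ∀ vh ∈ Wh, (∀ w ∈ W, B₀ vh w = 0) →
      C⁻¹ * B₀ vh vh ≤ ∑ j, B₀ (G j vh) (G j vh) ∧
        ∑ j, B₀ (G j vh) (G j vh) ≤ K * B₀ vh vh)
    (e : Fin m → V) (hemem : ∀ j, e j ∈ U j)
    (he : ∀ j, ∀ w ∈ U j, B₀ (e j) w = F w - B uW w)
    (μsq : ℝ) (hμsq : μsq = ∑ j, B₀ (e j) (e j))
    (β : ℝ) (hβ0 : 0 ≤ β) (hβ1 : β < 1)
    (hsat : Real.sqrt (B (u - uh) (u - uh)) ≤ β * Real.sqrt (B (u - uW) (u - uW))) :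
    lam / K * μsq ≤ Real.sqrt (B (u - uW) (u - uW)) ^ 2 ∧
      Real.sqrt (B (u - uW) (u - uW)) ^ 2 ≤ Lam * C / (1 - β ^ 2) * μsq := by
  have hBnonneg : ∀ v : V, 0 ≤ B v v := fun v => by
    obtain ⟨c, hc, h⟩ := hBcoer
    exact le_trans (by positivity) (h v)
  have hB₀nonneg : ∀ v : V, 0 ≤ B₀ v v := fun v => by
    obtain ⟨c, hc, h⟩ := hB₀coer
    exact le_trans (by positivity) (h v)
  have hB₀zero : ∀ v : V, B₀ v v = 0 → v = 0 := fun v hv => by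
    obtain ⟨c, hc, h⟩ := hB₀coer
    have h₁ : ‖v‖ ^ 2 ≤ 0 := nonpos_of_mul_nonpos_right (hv ▸ h v) hc
    exact norm_eq_zero.mp (pow_eq_zero_iff two_ne_zero |>.mp (le_antisymm h₁ (sq_nonneg _)))
  obtain ⟨M, hM⟩ := hBbdd
  obtain ⟨x, hx, hxB⟩ := exists_mem_forall_bilin_eq B₀ hB₀bdd hB₀coer Wh hWh
    ((B (uh - uW)).mkContinuous (M * ‖uh - uW‖) (hM (uh - uW)))
  replace hxB : ∀ w ∈ Wh, B₀ x w = B (uh - uW) w := hxB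
  have hd : uh - uW ∈ Wh := Wh.sub_mem huhmem (hWWh huWmem)
  have hres : ∀ w ∈ Wh, B₀ x w = F w - B uW w := fun w hw => by
    rw [hxB w hw, map_sub, LinearMap.sub_apply, huh w hw]
  have hG : ∀ j, G j x = e j := fun j => by
    have hmem : G j x - e j ∈ U j := (U j).sub_mem (hGmem j x) (hemem j)
    refine sub_eq_zero.mp (hB₀zero _ ?_)
    have h₁ := hGorth j x _ hmem
    have h₂ := he j _ hmem
    have h₃ := hres _ (hUWh j hmem)
    rw [map_sub B₀ x, LinearMap.sub_apply] at h₁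
    rw [map_sub B₀ (G j x), LinearMap.sub_apply]
    linarith
  obtain ⟨hlow, hup⟩ := hframe x hx fun w hw => by
    rw [hres w (hWWh hw), huW w hw, sub_self]
  simp only [hG, ← hμsq] at hlow hup
  obtain ⟨hdlow, hdup⟩ := energy_bounds_of_riesz_representative B B₀ hBsymm hB₀symm hBnonneg
    hB₀nonneg hlam hLam hequiv (hxB x hx) (hxB _ hd)
  have horth : B (u - uh) (uh - uW) = 0 := by
    rw [map_sub B, LinearMap.sub_apply, hu, huh _ hd, sub_self]
  have hpyth : B (u - uW) (u - uW) = B (u - uh) (u - uh) + B (uh - uW) (uh - uW) := by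
    have hsplit : u - uW = (u - uh) + (uh - uW) := by abel
    rw [hsplit, map_add B, LinearMap.add_apply, map_add (B (u - uh)), map_add (B (uh - uW)),
      hBsymm (uh - uW) (u - uh), horth]
    ring
  have hsat' : B (u - uh) (u - uh) ≤ β ^ 2 * B (u - uW) (u - uW) := by
    have h := pow_le_pow_left₀ (Real.sqrt_nonneg _) hsat 2
    rwa [mul_pow, Real.sq_sqrt (hBnonneg _), Real.sq_sqrt (hBnonneg _)] at h
  have hC0 : 0 < C := by linarith
  have hK0 : 0 < K := by linarith
  have hβ : 0 < 1 - β ^ 2 := by nlinarith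
  have hlow' : B₀ x x ≤ C * μsq := (inv_mul_le_iff₀ hC0).mp hlow
  rw [Real.sq_sqrt (hBnonneg _)]
  constructor
  · rw [div_mul_eq_mul_div, div_le_iff₀ hK0]
    calc lam * μsq ≤ lam * (K * B₀ x x) := mul_le_mul_of_nonneg_left hup hlam.le
      _ = lam * B₀ x x * K := by ring
      _ ≤ B (u - uW) (u - uW) * K :=
        mul_le_mul_of_nonneg_right (by linarith [hBnonneg (u - uh)]) hK0.le
  · rw [div_mul_eq_mul_div, le_div_iff₀ hβ]
    linarith [mul_le_mul_of_nonneg_left hlow' hLam.le]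
end

section
/- Let u ∈ V be the primal solution and z ∈ V the dual solution, let W ⊆ W̃ ⊆ V be closed subspaces, let u_W, z_W be the primal and dual Galerkin solutions on W, and let ũ, z̃ be the primal and dual Galerkin solutions on W̃. Then, with |||v||| := B(v,v)^{1/2}, the following identity holds: |||u − ũ|||²·|||z − z̃|||² = |||u − u_W|||²·|||z − z_W|||² + |||u_W − ũ|||²·|||z_W − z̃|||² − ( |||u − u_W|||²·|||z_W − z̃|||² + |||u_W − ũ|||²·|||z − z_W|||² ). -/
/-- Pythagorean identity for a symmetric bilinear form: if `u - p` is `B`-orthogonal to `p - q`,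
then `B (u - p) (u - p) = B (u - q) (u - q) - B (q - p) (q - p)`. -/
theorem LinearMap.apply_sub_self_eq_sub_of_orthogonal
    {R M : Type*} [CommRing R] [AddCommGroup M] [Module R M] (B : M →ₗ[R] M →ₗ[R] R)
    (hB : ∀ v w : M, B v w = B w v) {u p q : M} (h : B (u - p) (p - q) = 0) :
    B (u - p) (u - p) = B (u - q) (u - q) - B (q - p) (q - p) := by
  have hq : u - q = (u - p) + (p - q) := by abel
  have hqp : q - p = -(p - q) := by abel
  rw [hq, hqp]
  simp only [map_add, map_neg, LinearMap.add_apply, LinearMap.neg_apply, hB (p - q) (u - p), h]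
  ring

/-- Identity (4.6) for the reduction of the product of primal and dual energy
errors under enrichment of the approximation space:
`|||u − ũ|||²·|||z − z̃|||² = |||u − u_W|||²·|||z − z_W|||²
  + |||u_W − ũ|||²·|||z_W − z̃|||²
  − (|||u − u_W|||²·|||z_W − z̃|||² + |||u_W − ũ|||²·|||z − z_W|||²)`.
Here `Wt` denotes the enriched space `W̃`, and `ut`, `zt` denote the enriched
Galerkin solutions `ũ`, `z̃`; the energy norm is `|||v||| = B(v,v)^{1/2}`. -/
theorem product_energy_error_reduction_identity
    {V : Type*} [NormedAddCommGroup V] [InnerProductSpace ℝ V] [CompleteSpace V]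
    (B : V →ₗ[ℝ] V →ₗ[ℝ] ℝ)
    (hBsymm : ∀ v w : V, B v w = B w v)
    (hBbdd : ∃ M : ℝ, ∀ v w : V, |B v w| ≤ M * ‖v‖ * ‖w‖)
    (hBcoer : ∃ c : ℝ, 0 < c ∧ ∀ v : V, c * ‖v‖ ^ 2 ≤ B v v)
    (F G : V →L[ℝ] ℝ)
    (u z : V)
    (hu : ∀ v : V, B u v = F v)
    (hz : ∀ v : V, B v z = G v)
    (W Wt : Submodule ℝ V) (hWWt : W ≤ Wt)
    (hW : IsClosed ((W : Set V))) (hWt : IsClosed ((Wt : Set V)))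
    (uW zW : V) (huWmem : uW ∈ W) (hzWmem : zW ∈ W)
    (huW : ∀ w ∈ W, B uW w = F w) (hzW : ∀ w ∈ W, B w zW = G w)
    (ut zt : V) (hutmem : ut ∈ Wt) (hztmem : zt ∈ Wt)
    (hut : ∀ w ∈ Wt, B ut w = F w) (hzt : ∀ w ∈ Wt, B w zt = G w) :
    Real.sqrt (B (u - ut) (u - ut)) ^ 2 * Real.sqrt (B (z - zt) (z - zt)) ^ 2 =
      Real.sqrt (B (u - uW) (u - uW)) ^ 2 * Real.sqrt (B (z - zW) (z - zW)) ^ 2 +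
        Real.sqrt (B (uW - ut) (uW - ut)) ^ 2 * Real.sqrt (B (zW - zt) (zW - zt)) ^ 2 -
        (Real.sqrt (B (u - uW) (u - uW)) ^ 2 * Real.sqrt (B (zW - zt) (zW - zt)) ^ 2 +
          Real.sqrt (B (uW - ut) (uW - ut)) ^ 2 * Real.sqrt (B (z - zW) (z - zW)) ^ 2) := by
  obtain ⟨c, hc, hcoer⟩ := hBcoer
  have hnonneg (v : V) : 0 ≤ B v v := le_trans (by positivity) (hcoer v)
  have hu_orth : B (u - ut) (ut - uW) = 0 := by
    rw [map_sub B, LinearMap.sub_apply, hu, hut _ (Wt.sub_mem hutmem (hWWt huWmem)), sub_self]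
  have hz_orth : B (z - zt) (zt - zW) = 0 := by
    rw [hBsymm, map_sub, hz, hzt _ (Wt.sub_mem hztmem (hWWt hzWmem)), sub_self]
  simp only [Real.sq_sqrt (hnonneg _)]
  rw [B.apply_sub_self_eq_sub_of_orthogonal hBsymm hu_orth,
    B.apply_sub_self_eq_sub_of_orthogonal hBsymm hz_orth]
  ring
end
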